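/- arXiv:2406.19962 — 4 statements merged into one kernel-verified Lean document; each statement's English description precedes it below -/
import Mathlib

section
/- Let R be a commutative ring, let d be a natural number, and let F ∈ R[x] be palindromic of degree d. Then there exist unique elements γ_0, γ_1, …, γ_{⌊d/2⌋} of R such that F = Σ_{j=0}^{⌊d/2⌋} γ_j x^j (1+x)^{d−2j}. -/
open Polynomial

/-- Polynomials of the form `x^j u_j` with `u_j(0) = 1` are linearly independent. -/
theorem eq_zero_of_sum_C_mul_X_pow_mul_eq_zero {R : Type*} [CommRing R] (n : ℕ)
    (γ : ℕ → R) (u : ℕ → R[X]) (hu : ∀ j, (u j).coeff 0 = 1)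
    (h : ∑ j ∈ Finset.range n, C (γ j) * X ^ j * u j = 0) : ∀ j < n, γ j = 0 := by
  induction n generalizing γ u with
  | zero => intro j hj; omega
  | succ n ih =>
    have hsum : ∑ j ∈ Finset.range n, C (γ (j + 1)) * X ^ (j + 1) * u (j + 1) =
        X * ∑ j ∈ Finset.range n, C (γ (j + 1)) * X ^ j * u (j + 1) := by
      rw [Finset.mul_sum]
      exact Finset.sum_congr rfl fun j _ => by ring
    rw [Finset.sum_range_succ', hsum] at h
    have h0 : γ 0 = 0 := by simpa [mul_coeff_zero, hu] using congrArg (coeff · 0) h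
    rw [h0, C_0, zero_mul, zero_mul, add_zero] at h
    have hrest : ∑ j ∈ Finset.range n, C (γ (j + 1)) * X ^ j * u (j + 1) = 0 := by
      ext k
      simpa only [coeff_X_mul, coeff_zero] using congrArg (coeff · (k + 1)) h
    have ih' := ih (fun j => γ (j + 1)) (fun j => u (j + 1)) (fun j => hu (j + 1)) hrest
    rintro (_ | j) hj
    · exact h0
    · exact ih' j (by omega)

/-- A palindromic polynomial of degree `d` has a gamma expansion. -/
theorem exists_gamma_expansion {R : Type*} [CommRing R] (d : ℕ) (F : R[X])
    (hdeg : F.natDegree ≤ d) (hpal : ∀ j ≤ d, F.coeff j = F.coeff (d - j)) :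
    ∃ γ : ℕ → R, F = ∑ j ∈ Finset.range (d / 2 + 1),
      C (γ j) * X ^ j * (1 + X) ^ (d - 2 * j) := by
  induction d using Nat.twoStepInduction generalizing F with
  | zero =>
    refine ⟨F.coeff, ?_⟩
    simpa using eq_C_of_natDegree_le_zero hdeg
  | one =>
    refine ⟨F.coeff, ?_⟩
    have h1 : F.coeff 1 = F.coeff 0 := hpal 1 le_rfl
    conv_lhs => rw [eq_X_add_C_of_natDegree_le_one hdeg, h1]
    simp
    ring
  | more d ih _ =>
    set H : R[X] := F - C (F.coeff 0) * (1 + X) ^ (d + 2) with hH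
    have hcoeff (k : ℕ) : H.coeff k = F.coeff k - F.coeff 0 * ((d + 2).choose k : R) := by
      rw [hH, coeff_sub, coeff_C_mul, coeff_one_add_X_pow]
    have hH0 : H.coeff 0 = 0 := by simp [hcoeff]
    have hHpal (j : ℕ) (hj : j ≤ d + 2) : H.coeff j = H.coeff (d + 2 - j) := by
      rw [hcoeff, hcoeff, hpal j hj, Nat.choose_symm hj]
    have hHdeg (k : ℕ) (hk : d + 2 ≤ k) : H.coeff k = 0 := by
      obtain rfl | hk := hk.eq_or_lt
      · rw [hHpal _ le_rfl, Nat.sub_self, hH0]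
      · rw [hcoeff, coeff_eq_zero_of_natDegree_lt (hdeg.trans_lt hk),
          Nat.choose_eq_zero_of_lt hk]
        simp
    obtain ⟨γ, hγ⟩ := ih H.divX
      (natDegree_le_iff_coeff_eq_zero.2 fun k hk => by
        rw [coeff_divX]; exact hHdeg _ (by omega))
      (fun j hj => by
        rw [coeff_divX, coeff_divX, hHpal (j + 1) (by omega)]
        congr 1
        omega)
    refine ⟨fun j => j.casesOn (F.coeff 0) γ, ?_⟩
    have hF : F = X * H.divX + C (F.coeff 0) * (1 + X) ^ (d + 2) := by
      have h := X_mul_divX_add H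
      rw [hH0, C_0, add_zero] at h
      rw [h, hH]
      ring
    rw [show (d + 2) / 2 + 1 = d / 2 + 1 + 1 by omega, Finset.sum_range_succ']
    conv_lhs => rw [hF, hγ, Finset.mul_sum]
    congr 1
    · refine Finset.sum_congr rfl fun j _ => ?_
      rw [show d + 2 - 2 * (j + 1) = d - 2 * j by omega]
      ring
    · simp

/-- Every polynomial `F` over a commutative ring `R` that is palindromic of degree `d`
(i.e. `deg F ≤ d` and the coefficients of `x^j` and `x^(d-j)` agree for `0 ≤ j ≤ d`)
admits a unique expansion `F = ∑_{j=0}^{⌊d/2⌋} γ_j x^j (1+x)^(d-2j)` with `γ_j ∈ R`. -/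
theorem palindromic_gamma_expansion_exists_unique
    (R : Type*) [CommRing R] (d : ℕ) (F : Polynomial R)
    (hdeg : F.natDegree ≤ d)
    (hpal : ∀ j ≤ d, F.coeff j = F.coeff (d - j)) :
    ∃! γ : ℕ → R, (∀ j, d / 2 < j → γ j = 0) ∧
      F = ∑ j ∈ Finset.range (d / 2 + 1),
        Polynomial.C (γ j) * Polynomial.X ^ j * (1 + Polynomial.X) ^ (d - 2 * j) := by
  obtain ⟨γ, hγ⟩ := exists_gamma_expansion d F hdeg hpal
  refine ⟨fun j => if d / 2 < j then 0 else γ j, ⟨fun j hj => if_pos hj, ?_⟩, ?_⟩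
  · conv_lhs => rw [hγ]
    refine Finset.sum_congr rfl fun j hj => ?_
    have hj' : ¬ d / 2 < j := by rw [Finset.mem_range] at hj; omega
    simp only [if_neg hj']
  · rintro δ ⟨hδ, hFδ⟩
    funext j
    split_ifs with hj
    · exact hδ j hj
    · refine sub_eq_zero.1 (eq_zero_of_sum_C_mul_X_pow_mul_eq_zero (d / 2 + 1)
        (fun j => δ j - γ j) (fun j => (1 + X) ^ (d - 2 * j)) (fun j => ?_) ?_ j (by omega))
      · simp [coeff_one_add_X_pow]
      · simp only [C_sub, sub_mul, Finset.sum_sub_distrib]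
        rw [← hFδ, ← hγ, sub_self]
end

section
/- Let n ≥ 2 and let W be a subgroup of the symmetric group S_n on {1,…,n} of even order. For 0 ≤ j ≤ n let χ_j be the character of the permutation representation of W on the set of j-element subsets of {1,…,n}, and set F(x) = Σ_{j=0}^n χ_j x^j (this is the W-equivariant Z-polynomial of the Boolean matroid U_{n,n}, recorded at the level of characters). Then F is palindromic of degree n, and F is not Γ-positive over W; in fact, in the unique expansion F = Σ_{j=0}^{⌊n/2⌋} Γ_j x^j (1+x)^{n−2j}, the class function Γ_1 (which equals g ↦ fix(g) − n, where fix(g) is the number of fixed points of g on {1,…,n}) is not the character of any finite-dimensional complex representation of W. -/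
open Polynomial

/-- `f` is a character of `G`: it is the character of some finite-dimensional complex
representation of `G`. -/
def IsCharacter (G : Type) [Group G] (f : G → ℂ) : Prop :=
  ∃ V : FDRep ℂ G, f = V.character

/-- A polynomial `F` with class-function coefficients, palindromic of degree `d`, is
`Γ`-positive if in the (unique) expansion `F = ∑_j Γ_j x^j (1+x)^(d-2j)` every `Γ_j`
is a character, i.e. if such an expansion by characters exists. -/
def GammaPositive (G : Type) [Group G] (d : ℕ) (F : Polynomial (G → ℂ)) : Prop :=
  ∃ Γ : ℕ → (G → ℂ), (∀ j, IsCharacter G (Γ j)) ∧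
    F = ∑ j ∈ Finset.range (d / 2 + 1),
      Polynomial.C (Γ j) * Polynomial.X ^ j * (1 + Polynomial.X) ^ (d - 2 * j)

/-- The character of the permutation representation of `W ≤ S_n` on the `j`-element
subsets of `{1, …, n}`: it sends `w` to the number of `j`-subsets fixed setwise by `w`. -/
noncomputable def chiSubsets (n : ℕ) (W : Subgroup (Equiv.Perm (Fin n))) (j : ℕ) :
    ↥W → ℂ := fun w =>
  ((Finset.univ.filter fun s : Finset (Fin n) =>
      s.card = j ∧ s.image (w : Equiv.Perm (Fin n)) = s).card : ℂ)

/-- The `W`-equivariant `Z`-polynomial of the Boolean matroid `U_{n,n}`, recorded at the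
level of characters: `F(x) = ∑_{j=0}^n χ_j x^j`. -/
noncomputable def boolZ (n : ℕ) (W : Subgroup (Equiv.Perm (Fin n))) :
    Polynomial (↥W → ℂ) :=
  ∑ j ∈ Finset.range (n + 1), Polynomial.C (chiSubsets n W j) * Polynomial.X ^ j

/-- The class function `g ↦ fix(g) - n` on `W`, where `fix(g)` is the number of fixed
points of `g` on `{1, …, n}`. -/
noncomputable def fixMinusN (n : ℕ) (W : Subgroup (Equiv.Perm (Fin n))) : ↥W → ℂ :=
  fun w =>
    ((Finset.univ.filter fun x : Fin n => (w : Equiv.Perm (Fin n)) x = x).card : ℂ) - n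

theorem boolZ_coeff (n : ℕ) (W : Subgroup (Equiv.Perm (Fin n))) {j : ℕ} (hj : j ≤ n) :
    (boolZ n W).coeff j = chiSubsets n W j := by
  simp only [boolZ, finsetSum_coeff, coeff_C_mul_X_pow]
  rw [Finset.sum_ite_eq, if_pos (Finset.mem_range.mpr (by omega))]

theorem boolZ_natDegree_le (n : ℕ) (W : Subgroup (Equiv.Perm (Fin n))) :
    (boolZ n W).natDegree ≤ n :=
  natDegree_sum_le_of_forall_le _ _ fun j hj =>
    (natDegree_C_mul_X_pow_le _ j).trans (by simpa [Nat.lt_succ_iff] using hj)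

theorem chiSubsets_compl (n : ℕ) (W : Subgroup (Equiv.Perm (Fin n))) {j : ℕ} (hj : j ≤ n) :
    chiSubsets n W j = chiSubsets n W (n - j) := by
  funext w
  have image_compl (s : Finset (Fin n)) :
      sᶜ.image (w : Equiv.Perm (Fin n)) = (s.image (w : Equiv.Perm (Fin n)))ᶜ := by
    ext x
    simp [Finset.mem_image, ← Equiv.eq_symm_apply]
  have card_le (s : Finset (Fin n)) : s.card ≤ n := by simpa using s.card_le_univ
  simp only [chiSubsets, Nat.cast_inj]
  refine Finset.card_bij' (fun s _ => sᶜ) (fun s _ => sᶜ) ?_ ?_ (by simp) (by simp)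
  all_goals
    intro s hs
    have := card_le s
    simp only [Finset.mem_filter, Finset.mem_univ, true_and] at hs ⊢
    refine ⟨?_, by rw [image_compl, hs.2]⟩
    rw [Finset.card_compl, Fintype.card_fin]
    omega

theorem chiSubsets_zero (n : ℕ) (W : Subgroup (Equiv.Perm (Fin n))) :
    chiSubsets n W 0 = 1 := by
  funext w
  have : (Finset.univ.filter fun s : Finset (Fin n) =>
      s.card = 0 ∧ s.image (w : Equiv.Perm (Fin n)) = s) = {∅} := by
    ext s
    simp only [Finset.mem_filter, Finset.mem_univ, true_and, Finset.card_eq_zero,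
      Finset.mem_singleton, and_iff_left_iff_imp]
    rintro rfl
    simp
  simp only [chiSubsets, this, Finset.card_singleton, Nat.cast_one, Pi.one_apply]

theorem chiSubsets_one (n : ℕ) (W : Subgroup (Equiv.Perm (Fin n))) (w : ↥W) :
    chiSubsets n W 1 w =
      (Finset.univ.filter fun x : Fin n => (w : Equiv.Perm (Fin n)) x = x).card := by
  simp only [chiSubsets, Nat.cast_inj]
  symm
  refine Finset.card_bij (fun x _ => {x}) ?_ (by simp) ?_
  · intro x hx
    simpa using hx
  · intro s hs
    simp only [Finset.mem_filter, Finset.mem_univ, true_and] at hs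
    obtain ⟨x, rfl⟩ := Finset.card_eq_one.mp hs.1
    exact ⟨x, by simpa using hs.2, rfl⟩

theorem gamma_expansion_coeff_zero {R : Type*} [CommSemiring R] (d : ℕ) (Γ : ℕ → R) :
    (∑ j ∈ Finset.range (d / 2 + 1),
      C (Γ j) * X ^ j * (1 + X) ^ (d - 2 * j)).coeff 0 = Γ 0 := by
  rw [Finset.sum_range_succ']
  simp [mul_assoc, coeff_one_add_X_pow]

theorem gamma_expansion_coeff_one {R : Type*} [CommSemiring R] {d : ℕ} (hd : 2 ≤ d)
    (Γ : ℕ → R) :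
    (∑ j ∈ Finset.range (d / 2 + 1),
      C (Γ j) * X ^ j * (1 + X) ^ (d - 2 * j)).coeff 1 = Γ 1 + Γ 0 * d := by
  obtain ⟨k, hk⟩ : ∃ k, d / 2 = k + 1 := ⟨d / 2 - 1, by omega⟩
  rw [hk, Finset.sum_range_succ', Finset.sum_range_succ']
  simp [mul_assoc, coeff_X_pow_mul', coeff_one_add_X_pow]

theorem gamma_one_eq_fixMinusN {n : ℕ} (hn : 2 ≤ n) (W : Subgroup (Equiv.Perm (Fin n)))
    (Γ : ℕ → (↥W → ℂ))
    (h : boolZ n W = ∑ j ∈ Finset.range (n / 2 + 1),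
      C (Γ j) * X ^ j * (1 + X) ^ (n - 2 * j)) :
    Γ 1 = fixMinusN n W := by
  have h0 : Γ 0 = 1 := by
    rw [← gamma_expansion_coeff_zero n Γ, ← h, boolZ_coeff n W n.zero_le, chiSubsets_zero]
  have h1 : chiSubsets n W 1 = Γ 1 + n := by
    rw [← boolZ_coeff n W (by omega), h, gamma_expansion_coeff_one hn, h0, one_mul]
  funext w
  rw [fixMinusN, ← chiSubsets_one, h1]
  simp

/-- A character vanishing at the identity is zero. -/
theorem IsCharacter.eq_zero {G : Type} [Group G] {f : G → ℂ} (hf : IsCharacter G f)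
    (h1 : f 1 = 0) : f = 0 := by
  obtain ⟨V, rfl⟩ := hf
  rw [FDRep.char_one, Nat.cast_eq_zero] at h1
  have := Module.finrank_zero_iff.mp h1
  funext g
  rw [FDRep.character, Subsingleton.elim (V.ρ g) 0]
  simp

theorem fixMinusN_not_isCharacter (n : ℕ) (W : Subgroup (Equiv.Perm (Fin n)))
    (hW : Nontrivial ↥W) : ¬ IsCharacter (↥W) (fixMinusN n W) := by
  intro h
  obtain ⟨w, hw⟩ := exists_ne (1 : ↥W)
  have hz := congrFun (h.eq_zero (by simp [fixMinusN])) w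
  simp only [fixMinusN, Pi.zero_apply, sub_eq_zero, Nat.cast_inj] at hz
  refine hw (Subtype.ext (Equiv.ext fun x => ?_))
  have huniv := (Finset.card_eq_iff_eq_univ _).mp (hz.trans (Fintype.card_fin n).symm)
  simpa using Finset.ext_iff.mp huniv x

/-- For `n ≥ 2` and `W ≤ S_n` of even order, the equivariant `Z`-polynomial
`F = ∑_{j=0}^n χ_j x^j` of the Boolean matroid `U_{n,n}` is palindromic of degree `n`
but not `Γ`-positive over `W`: in any expansion `F = ∑_j Γ_j x^j (1+x)^(n-2j)`, the
class function `Γ_1` equals `g ↦ fix(g) - n` and is not a character of `W`. -/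
theorem boolean_Z_not_gamma_positive (n : ℕ) (hn : 2 ≤ n)
    (W : Subgroup (Equiv.Perm (Fin n))) (heven : Even (Nat.card ↥W)) :
    ((boolZ n W).natDegree ≤ n ∧
        ∀ j ≤ n, (boolZ n W).coeff j = (boolZ n W).coeff (n - j)) ∧
    ¬ GammaPositive (↥W) n (boolZ n W) ∧
    ∀ Γ : ℕ → (↥W → ℂ),
      boolZ n W = ∑ j ∈ Finset.range (n / 2 + 1),
        Polynomial.C (Γ j) * Polynomial.X ^ j * (1 + Polynomial.X) ^ (n - 2 * j) →
      Γ 1 = fixMinusN n W ∧ ¬ IsCharacter (↥W) (Γ 1) := by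
  have hW : Nontrivial ↥W := by
    rw [← Finite.one_lt_card_iff_nontrivial]
    obtain ⟨k, hk⟩ := heven
    have : 0 < Nat.card ↥W := Nat.card_pos
    omega
  have hΓ (Γ : ℕ → (↥W → ℂ)) (h : boolZ n W = ∑ j ∈ Finset.range (n / 2 + 1),
      C (Γ j) * X ^ j * (1 + X) ^ (n - 2 * j)) :
      Γ 1 = fixMinusN n W ∧ ¬ IsCharacter (↥W) (Γ 1) := by
    have h1 := gamma_one_eq_fixMinusN hn W Γ h
    exact ⟨h1, h1 ▸ fixMinusN_not_isCharacter n W hW⟩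
  refine ⟨⟨boolZ_natDegree_le n W, fun j hj => ?_⟩, ?_, hΓ⟩
  · rw [boolZ_coeff n W hj, boolZ_coeff n W (n.sub_le j), chiSubsets_compl n W hj]
  · rintro ⟨Γ, hchar, h⟩
    exact (hΓ Γ h).2 (hchar 1)
end

section
/- Fix integers N and i with i ≥ 1 and N ≥ 2i + 2, and let λ = (N−2i, 2, 2, …, 2) with i parts equal to 2. Let μ and ν be partitions with μ ⊆ λ, ν ⊆ λ and |μ| + |ν| = N, and set p = μ_1, d = |μ|, ℓ = #{j ≥ 2 : μ_j = 2}, q = ν_1, s = #{j ≥ 2 : ν_j = 2}. Then c(λ; μ, ν) ≤ 1, and if c(λ; μ, ν) ≠ 0 then the pair (q, s) equals one of the four pairs (N−2i−p, p+i−d+ℓ), (N−2i−p+1, p+i−d+ℓ), (N−2i−p+1, p+i−d+ℓ−1), (N−2i−p+2, p+i−d+ℓ−1). -/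
namespace LRPaper

/-- The cells of the skew Young diagram `λ/μ`: pairs `(row, column)` (both `0`-indexed)
with `μ_row ≤ column < λ_row`. Partitions are recorded by the (`0`-indexed) sequence of
their row lengths. -/
def skewCells (lam mu : ℕ → ℕ) : Set (ℕ × ℕ) :=
  {p | mu p.1 ≤ p.2 ∧ p.2 < lam p.1}

/-- `T` is a Littlewood–Richardson tableau of shape `λ/μ` and content `ν`: a filling of
the cells of `λ/μ` with positive integers, weakly increasing along rows, strictly
increasing down columns, using the value `k` exactly `ν_k` times, and whose reverse
reading word (rows read right to left, from top to bottom) is a lattice word. (`T` is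
normalized to vanish off the skew shape.) -/
def IsLRTableau (lam mu nu : ℕ → ℕ) (T : ℕ × ℕ → ℕ) : Prop :=
  (∀ p, p ∉ skewCells lam mu → T p = 0) ∧
  (∀ p ∈ skewCells lam mu, 1 ≤ T p) ∧
  (∀ i j j', j < j' → mu i ≤ j → j' < lam i → T (i, j) ≤ T (i, j')) ∧
  (∀ i i' j, i < i' → (i, j) ∈ skewCells lam mu → (i', j) ∈ skewCells lam mu →
    T (i, j) < T (i', j)) ∧
  (∀ k : ℕ, 1 ≤ k → {p ∈ skewCells lam mu | T p = k}.ncard = nu (k - 1)) ∧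
  (∀ p ∈ skewCells lam mu, ∀ k : ℕ, 1 ≤ k →
    {q ∈ skewCells lam mu | (q.1 < p.1 ∨ (q.1 = p.1 ∧ p.2 ≤ q.2)) ∧ T q = k + 1}.ncard ≤
    {q ∈ skewCells lam mu | (q.1 < p.1 ∨ (q.1 = p.1 ∧ p.2 ≤ q.2)) ∧ T q = k}.ncard)

/-- The Littlewood–Richardson coefficient `c(λ; μ, ν)`: the number of
Littlewood–Richardson tableaux of shape `λ/μ` and content `ν`. -/
noncomputable def lrCoeff (lam mu nu : ℕ → ℕ) : ℕ :=
  Set.ncard {T : ℕ × ℕ → ℕ | IsLRTableau lam mu nu T}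

/-- The partition `λ = (N - 2i, 2, 2, …, 2)` with `i` parts equal to `2`. -/
def fatHook (N i : ℕ) : ℕ → ℕ :=
  fun r => if r = 0 then N - 2 * i else if r ≤ i then 2 else 0

/-- A partition contained in the fat hook is, below its first row, of the form `(2^l, 1^m)`. -/
theorem exists_fatHook_subpartition {N i : ℕ} {mu : ℕ → ℕ} (hmu : Antitone mu)
    (hsub : ∀ r, mu r ≤ fatHook N i r) :
    ∃ l m, l + m ≤ i ∧
      ∀ r, 1 ≤ r → mu r = if r ≤ l then 2 else if r ≤ l + m then 1 else 0 := by
  have hle : ∀ r, 1 ≤ r → mu r ≤ 2 ∧ (i < r → mu r = 0) := by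
    intro r hr
    have h := hsub r
    simp only [fatHook] at h
    split_ifs at h <;> omega
  have h2 : ∃ n, mu (n + 1) ≤ 1 := ⟨i, by have := (hle (i + 1) (by omega)).2; omega⟩
  have h1 : ∃ n, mu (n + 1) = 0 := ⟨i, (hle (i + 1) (by omega)).2 (by omega)⟩
  classical
  have hl := Nat.find_spec h2
  have hk := Nat.find_spec h1
  have hl' : ∀ n, n < Nat.find h2 → ¬ mu (n + 1) ≤ 1 := fun n hn => Nat.find_min h2 hn
  have hk' : ∀ n, n < Nat.find h1 → ¬ mu (n + 1) = 0 := fun n hn => Nat.find_min h1 hn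
  have hki : Nat.find h1 ≤ i := Nat.find_min' h1 ((hle (i + 1) (by omega)).2 (by omega))
  have hlk : Nat.find h2 ≤ Nat.find h1 := Nat.find_min' h2 (by omega)
  generalize Nat.find h2 = l at *
  generalize Nat.find h1 = k at *
  refine ⟨l, k - l, by omega, fun r hr => ?_⟩
  obtain ⟨n, rfl⟩ : ∃ n, r = n + 1 := ⟨r - 1, by omega⟩
  have hb := (hle (n + 1) hr).1
  split_ifs with c1 c2
  · have := hl' n (by omega)
    omega
  · have := hk' n (by omega)
    have := hmu (show l + 1 ≤ n + 1 by omega)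
    omega
  · have := hmu (show k + 1 ≤ n + 1 by omega)
    omega

theorem finsum_eq_of_two_one_tail {mu : ℕ → ℕ} {l m : ℕ}
    (h : ∀ r, 1 ≤ r → mu r = if r ≤ l then 2 else if r ≤ l + m then 1 else 0) :
    ∑ᶠ r, mu r = mu 0 + 2 * l + m := by
  have hsupp : Function.support mu ⊆ (Finset.range (l + m + 1) : Finset ℕ) := by
    intro r hr
    by_contra hlt
    simp only [Finset.coe_range, Set.mem_Iio, not_lt] at hlt
    apply hr
    rw [h r (by omega), if_neg (by omega), if_neg (by omega)]
  rw [finsum_eq_sum_of_support_subset _ hsupp, Finset.sum_range_succ', Finset.sum_range_add]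
  have e1 : ∑ x ∈ Finset.range l, mu (x + 1) = ∑ _x ∈ Finset.range l, 2 :=
    Finset.sum_congr rfl fun x hx => by
      have := Finset.mem_range.1 hx
      rw [h _ (by omega), if_pos (by omega)]
  have e2 : ∑ x ∈ Finset.range m, mu (l + x + 1) = ∑ _x ∈ Finset.range m, 1 :=
    Finset.sum_congr rfl fun x hx => by
      have := Finset.mem_range.1 hx
      rw [h _ (by omega), if_neg (by omega), if_pos (by omega)]
  rw [e1, e2]
  simp
  ring

theorem ncard_eq_two_of_two_one_tail {mu : ℕ → ℕ} {l m : ℕ}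
    (h : ∀ r, 1 ≤ r → mu r = if r ≤ l then 2 else if r ≤ l + m then 1 else 0) :
    {r : ℕ | 1 ≤ r ∧ mu r = 2}.ncard = l := by
  have : {r : ℕ | 1 ≤ r ∧ mu r = 2} = (Finset.Icc 1 l : Finset ℕ) := by
    ext r
    simp only [Set.mem_ofPred_eq, Finset.coe_Icc, Set.mem_Icc]
    refine and_congr_right fun hr => ?_
    have := h r hr
    split_ifs at this <;> omega
  rw [this, Set.ncard_coe_finset]
  simp

theorem mem_skewCells_fatHook {N i l m : ℕ} {mu : ℕ → ℕ}
    (h : ∀ r, 1 ≤ r → mu r = if r ≤ l then 2 else if r ≤ l + m then 1 else 0) {r c : ℕ} :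
    (r, c) ∈ skewCells (fatHook N i) mu ↔
      (r = 0 ∧ mu 0 ≤ c ∧ c < N - 2 * i) ∨
      (1 ≤ r ∧ r ≤ i ∧ ((c = 0 ∧ l + m < r) ∨ (c = 1 ∧ l < r))) := by
  rcases Nat.eq_zero_or_pos r with rfl | hr
  · simp [skewCells, fatHook]
  · have := h r hr
    simp only [skewCells, fatHook, Set.mem_ofPred_eq]
    split_ifs at * <;> omega

theorem finite_skewCells_fatHook (N i : ℕ) (mu : ℕ → ℕ) :
    (skewCells (fatHook N i) mu).Finite := by
  refine ((Finset.range (i + 1) ×ˢ Finset.range (N + 2)).finite_toSet).subset ?_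
  rintro ⟨r, c⟩ ⟨-, h⟩
  simp only [fatHook] at h
  simp only [Finset.coe_product, Finset.coe_range, Set.mem_prod, Set.mem_Iio]
  split_ifs at h <;> omega

/-- In a Littlewood–Richardson tableau, an entry `k + 1` with `k ≥ 1` is preceded by some `k`
in the reverse reading word. -/
theorem IsLRTableau.exists_pred {lam mu nu : ℕ → ℕ} {T : ℕ × ℕ → ℕ}
    (hT : IsLRTableau lam mu nu T) (hfin : (skewCells lam mu).Finite) {r c k : ℕ} (hk : 1 ≤ k)
    (hmem : (r, c) ∈ skewCells lam mu) (hval : T (r, c) = k + 1) :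
    ∃ r' c', (r', c') ∈ skewCells lam mu ∧ (r' < r ∨ r' = r ∧ c < c') ∧ T (r', c') = k := by
  obtain ⟨-, -, -, -, -, hlat⟩ := hT
  have h := hlat (r, c) hmem k hk
  have hpos : 0 < {q ∈ skewCells lam mu |
      (q.1 < r ∨ (q.1 = r ∧ c ≤ q.2)) ∧ T q = k + 1}.ncard :=
    (Set.ncard_pos (hfin.subset (Set.sep_subset _ _))).2 ⟨(r, c), hmem, by simp, hval⟩
  obtain ⟨⟨r', c'⟩, hm, ho, hv⟩ :=
    (Set.ncard_pos (hfin.subset (Set.sep_subset _ _))).1 (hpos.trans_le h)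
  refine ⟨r', c', hm, ?_, hv⟩
  rcases ho with ho | ⟨ho, hc⟩
  · exact Or.inl ho
  · refine Or.inr ⟨ho, lt_of_le_of_ne hc fun hcc => ?_⟩
    simp only at ho hcc
    subst ho hcc
    omega

/-- If an entry `k + 1` at `(r, c)` is the second one of its value in the reverse reading word,
then it is preceded by two entries `k`. -/
theorem IsLRTableau.exists_two_pred {lam mu nu : ℕ → ℕ} {T : ℕ × ℕ → ℕ}
    (hT : IsLRTableau lam mu nu T) (hfin : (skewCells lam mu).Finite) {r c r₁ c₁ k : ℕ}
    (hk : 1 ≤ k) (hmem : (r, c) ∈ skewCells lam mu) (hval : T (r, c) = k + 1)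
    (hmem₁ : (r₁, c₁) ∈ skewCells lam mu) (hval₁ : T (r₁, c₁) = k + 1)
    (hbefore : r₁ < r ∨ r₁ = r ∧ c < c₁) :
    ∃ a b : ℕ × ℕ, a ≠ b ∧
      (a ∈ skewCells lam mu ∧ (a.1 < r ∨ a.1 = r ∧ c ≤ a.2) ∧ T a = k) ∧
      (b ∈ skewCells lam mu ∧ (b.1 < r ∨ b.1 = r ∧ c ≤ b.2) ∧ T b = k) := by
  obtain ⟨-, -, -, -, -, hlat⟩ := hT
  have h := hlat (r, c) hmem k hk
  have htwo : 1 < {q ∈ skewCells lam mu |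
      (q.1 < r ∨ (q.1 = r ∧ c ≤ q.2)) ∧ T q = k + 1}.ncard := by
    refine (Set.one_lt_ncard (hfin.subset (Set.sep_subset _ _))).2
      ⟨(r, c), ⟨hmem, by simp, hval⟩, (r₁, c₁), ⟨hmem₁, ?_, hval₁⟩, ?_⟩
    · simp only
      omega
    · simp only [ne_eq, Prod.mk.injEq]
      omega
  obtain ⟨a, ha, b, hb, hab⟩ :=
    (Set.one_lt_ncard (hfin.subset (Set.sep_subset _ _))).1 (htwo.trans_le h)
  exact ⟨a, b, hab, ha, hb⟩

section FatHook

variable {N i l m : ℕ} {mu nu : ℕ → ℕ} {T : ℕ × ℕ → ℕ}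

theorem IsLRTableau.fatHook_row_zero (hT : IsLRTableau (fatHook N i) mu nu T) {c : ℕ}
    (hc : mu 0 ≤ c) (hcN : c < N - 2 * i) : T (0, c) = 1 := by
  have hfin := finite_skewCells_fatHook N i mu
  have hmem : ∀ c, mu 0 ≤ c → c < N - 2 * i → (0, c) ∈ skewCells (fatHook N i) mu :=
    fun c h h' => ⟨h, by simpa [fatHook] using h'⟩
  have hlast : T (0, N - 2 * i - 1) ≤ 1 := by
    by_contra hgt
    obtain ⟨r', c', ⟨-, hm⟩, ho, -⟩ := hT.exists_pred hfin (k := T (0, N - 2 * i - 1) - 1)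
      (by omega) (hmem (N - 2 * i - 1) (by omega) (by omega)) (by omega)
    obtain ⟨rfl, ho⟩ : r' = 0 ∧ N - 2 * i - 1 < c' := by
      clear hm
      omega
    have hm' : c' < N - 2 * i := by simpa [fatHook] using hm
    omega
  obtain ⟨-, hpos, hrow, -⟩ := hT
  have h1 := hpos _ (hmem c hc hcN)
  rcases Nat.lt_or_ge c (N - 2 * i - 1) with hlt | hge
  · have := hrow 0 c (N - 2 * i - 1) hlt hc (by simp only [fatHook, if_true]; omega)
    omega
  · have : c = N - 2 * i - 1 := by omega
    subst this
    omega

/-- Below the first row, the second column is filled with consecutive integers starting from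
`1` or `2`. -/
theorem IsLRTableau.exists_fatHook_col_one (hT : IsLRTableau (fatHook N i) mu nu T)
    (h : ∀ r, 1 ≤ r → mu r = if r ≤ l then 2 else if r ≤ l + m then 1 else 0) :
    ∃ e ≤ 1, (i ≤ l → e = 0) ∧ ∀ r, l < r → r ≤ i → T (r, 1) + e = r - l + 1 := by
  have hfin := finite_skewCells_fatHook N i mu
  have hpred : ∀ r, l < r → r ≤ i → 3 ≤ T (r, 1) →
      ∃ r', l < r' ∧ r' < r ∧ T (r, 1) ≤ T (r', 1) + 1 := by
    intro r hl hi h3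
    have hmem := (mem_skewCells_fatHook (N := N) (i := i) (r := r) (c := 1) h).2 (by omega)
    obtain ⟨r', c', hm, ho, hv⟩ := hT.exists_pred hfin (k := T (r, 1) - 1) (by omega) hmem
      (by omega)
    rcases (mem_skewCells_fatHook h).1 hm with ⟨rfl, hc⟩ | ⟨h1, hi', hc⟩
    · have := hT.fatHook_row_zero hc.1 hc.2
      omega
    · refine ⟨r', by omega, by omega, ?_⟩
      rcases hc with ⟨rfl, hc⟩ | ⟨rfl, hc⟩
      · have hmu' : mu r' ≤ 0 := hm.1
        have := hT.2.2.1 r' 0 1 (by omega) hmu' (by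
          simp only [fatHook]; split_ifs <;> omega)
        omega
      · omega
  have hstrict : ∀ r r', l < r → r < r' → r' ≤ i → T (r, 1) < T (r', 1) := fun r r' h1 h2 h3 =>
    hT.2.2.2.1 r r' 1 h2 ((mem_skewCells_fatHook h).2 (by omega))
      ((mem_skewCells_fatHook h).2 (by omega))
  have hpos : ∀ r, l < r → r ≤ i → 1 ≤ T (r, 1) := fun r h1 h2 =>
    hT.2.1 _ ((mem_skewCells_fatHook h).2 (by omega))
  rcases Nat.lt_or_ge l i with hli | hli
  · have hfirst : T (l + 1, 1) ≤ 2 := by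
      by_contra hgt
      obtain ⟨r', h1, h2, -⟩ := hpred (l + 1) (by omega) (by omega) (by omega)
      omega
    have hone := hpos (l + 1) (by omega) (by omega)
    refine ⟨2 - T (l + 1, 1), by omega, by omega, fun r hr => ?_⟩
    induction r, hr using Nat.le_induction with
    | base => intro _; simp only [Nat.succ_eq_add_one]; omega
    | succ r hr ih =>
      intro hri
      have ih := ih (by omega)
      have hs := hstrict r (r + 1) hr (by omega) hri
      have hp := hpos r hr (by omega)
      have : T (r + 1, 1) ≤ T (r, 1) + 1 := by
        by_contra hgt
        obtain ⟨r', h1, h2, h3⟩ := hpred (r + 1) (by omega) (by omega) (by omega)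
        rcases Nat.lt_or_ge r' r with h4 | h4
        · have := hstrict r' r h1 h4 (by omega)
          omega
        · have : r' = r := by omega
          subst this
          omega
      omega
  · exact ⟨0, by omega, fun _ => rfl, fun r h1 h2 => by omega⟩

/-- Below the first row, the first column is filled with consecutive integers starting from
`1` or `2`. -/
theorem IsLRTableau.exists_fatHook_col_zero (hT : IsLRTableau (fatHook N i) mu nu T)
    (h : ∀ r, 1 ≤ r → mu r = if r ≤ l then 2 else if r ≤ l + m then 1 else 0) :
    ∃ e ≤ 1, (i ≤ l + m → e = 0) ∧
      ∀ r, l + m < r → r ≤ i → T (r, 0) + e = r - (l + m) + 1 := by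
  have hfin := finite_skewCells_fatHook N i mu
  obtain ⟨e₁, he₁, -, hcol⟩ := hT.exists_fatHook_col_one h
  have hpred : ∀ r, l + m < r → r ≤ i → 3 ≤ T (r, 0) →
      ∃ r', l + m < r' ∧ r' < r ∧ T (r, 0) = T (r', 0) + 1 := by
    intro r hl hi h3
    have hm := (mem_skewCells_fatHook (N := N) (i := i) (r := r) (c := 0) h).2 (by omega)
    have hmu' : mu r ≤ 0 := hm.1
    have hrow := hT.2.2.1 r 0 1 (by omega) hmu' (by simp only [fatHook]; split_ifs <;> omega)
    have hr := hcol r (by omega) hi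
    have hr₁ := hcol (l + T (r, 0) + e₁ - 1) (by omega) (by omega)
    obtain ⟨⟨ra, ca⟩, ⟨rb, cb⟩, hab, ⟨hma, hoa, hva⟩, ⟨hmb, hob, hvb⟩⟩ :=
      hT.exists_two_pred hfin (k := T (r, 0) - 1) (r₁ := l + T (r, 0) + e₁ - 1) (c₁ := 1)
        (by omega) hm (by omega)
        ((mem_skewCells_fatHook h).2 (by omega)) (by omega) (by omega)
    simp only at hoa hob
    rcases (mem_skewCells_fatHook h).1 hma with ⟨rfl, hc⟩ | ⟨h1, hi', hc⟩
    · have := hT.fatHook_row_zero hc.1 hc.2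
      omega
    rcases (mem_skewCells_fatHook h).1 hmb with ⟨rfl, hc'⟩ | ⟨h1', hi'', hc'⟩
    · have := hT.fatHook_row_zero hc'.1 hc'.2
      omega
    have hlt : ∀ r' ≤ r, T (r', 0) = T (r, 0) - 1 → r' < r := by
      intro r' ho hv
      refine lt_of_le_of_ne ho ?_
      rintro rfl
      omega
    rcases hc with ⟨rfl, hc⟩ | ⟨rfl, hc⟩
    · exact ⟨ra, hc, hlt ra (by omega) hva, by omega⟩
    rcases hc' with ⟨rfl, hc'⟩ | ⟨rfl, hc'⟩
    · exact ⟨rb, hc', hlt rb (by omega) hvb, by omega⟩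
    have h3 := hcol ra hc hi'
    have h4 := hcol rb hc' hi''
    exact absurd (by omega : ra = rb) fun hh => hab (by rw [hh])
  have hstrict : ∀ r r', l + m < r → r < r' → r' ≤ i → T (r, 0) < T (r', 0) :=
    fun r r' h1 h2 h3 => hT.2.2.2.1 r r' 0 h2 ((mem_skewCells_fatHook h).2 (by omega))
      ((mem_skewCells_fatHook h).2 (by omega))
  have hpos : ∀ r, l + m < r → r ≤ i → 1 ≤ T (r, 0) := fun r h1 h2 =>
    hT.2.1 _ ((mem_skewCells_fatHook h).2 (by omega))
  rcases Nat.lt_or_ge (l + m) i with hli | hli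
  · have hfirst : T (l + m + 1, 0) ≤ 2 := by
      by_contra hgt
      obtain ⟨r', h1, h2, -⟩ := hpred (l + m + 1) (by omega) (by omega) (by omega)
      omega
    have hone := hpos (l + m + 1) (by omega) (by omega)
    refine ⟨2 - T (l + m + 1, 0), by omega, by omega, fun r hr => ?_⟩
    induction r, hr using Nat.le_induction with
    | base => intro _; simp only [Nat.succ_eq_add_one]; omega
    | succ r hr ih =>
      intro hri
      have ih := ih (by omega)
      have hs := hstrict r (r + 1) hr (by omega) hri
      have hp := hpos r hr (by omega)
      have : T (r + 1, 0) ≤ T (r, 0) + 1 := by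
        by_contra hgt
        obtain ⟨r', h1, h2, h3⟩ := hpred (r + 1) (by omega) (by omega) (by omega)
        rcases Nat.lt_or_ge r' r with h4 | h4
        · have := hstrict r' r h1 h4 (by omega)
          omega
        · have : r' = r := by omega
          subst this
          omega
      omega
  · exact ⟨0, by omega, fun _ => rfl, fun r h1 h2 => by omega⟩

/-- A Littlewood–Richardson tableau of shape `λ/μ`, for `λ` a fat hook, is determined by two
numbers `e₀, e₁ ≤ 1`, which in turn are determined by the content. -/
theorem IsLRTableau.exists_fatHook_params (hT : IsLRTableau (fatHook N i) mu nu T)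
    (hmu0 : mu 0 ≤ N - 2 * i) (hlm : l + m ≤ i)
    (h : ∀ r, 1 ≤ r → mu r = if r ≤ l then 2 else if r ≤ l + m then 1 else 0) :
    ∃ e₀ ≤ 1, ∃ e₁ ≤ 1,
      (∀ r, l + m < r → r ≤ i → T (r, 0) + e₀ = r - (l + m) + 1) ∧
      (∀ r, l < r → r ≤ i → T (r, 1) + e₁ = r - l + 1) ∧
      nu 0 + mu 0 = N - 2 * i + e₀ + e₁ ∧
      {r : ℕ | 1 ≤ r ∧ nu r = 2}.ncard + e₀ = i - (l + m) := by
  obtain ⟨e₁, he₁, hz₁, hc₁⟩ := hT.exists_fatHook_col_one h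
  obtain ⟨e₀, he₀, hz₀, hc₀⟩ := hT.exists_fatHook_col_zero h
  refine ⟨e₀, he₀, e₁, he₁, hc₀, hc₁, ?_, ?_⟩
  · have hcount : {q ∈ skewCells (fatHook N i) mu | T q = 1}.ncard = nu 0 :=
      hT.2.2.2.2.1 1 le_rfl
    have hset : {q ∈ skewCells (fatHook N i) mu | T q = 1} =
        (((Finset.Ico (mu 0) (N - 2 * i)).image (fun c => (0, c)) ∪
          ((Finset.range e₀).image (fun _ => (l + m + 1, 0)) ∪
          (Finset.range e₁).image (fun _ => (l + 1, 1))) : Finset (ℕ × ℕ)) : Set (ℕ × ℕ)) := by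
      ext ⟨r, c⟩
      simp only [Set.mem_ofPred_eq, Finset.coe_union, Finset.coe_image, Finset.coe_Ico,
        Finset.coe_range, Set.mem_union, Set.mem_image, Set.mem_Ico, Set.mem_Iio, Prod.mk.injEq]
      rw [mem_skewCells_fatHook h]
      constructor
      · rintro ⟨⟨rfl, hc⟩ | ⟨h1, hi', ⟨rfl, hc⟩ | ⟨rfl, hc⟩⟩, hv⟩
        · exact Or.inl ⟨c, hc, rfl, rfl⟩
        · have := hc₀ r hc hi'
          exact Or.inr (Or.inl ⟨0, by omega, by omega, rfl⟩)
        · have := hc₁ r hc hi'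
          exact Or.inr (Or.inr ⟨0, by omega, by omega, rfl⟩)
      · rintro (⟨c', hc, rfl, rfl⟩ | ⟨x, hx, rfl, rfl⟩ | ⟨x, hx, rfl, rfl⟩)
        · exact ⟨Or.inl ⟨rfl, hc⟩, hT.fatHook_row_zero hc.1 hc.2⟩
        · have := hc₀ (l + m + 1) (by omega) (by omega)
          exact ⟨by omega, by omega⟩
        · have := hc₁ (l + 1) (by omega) (by omega)
          exact ⟨by omega, by omega⟩
    have hcard : ∀ (e : ℕ) (a : ℕ × ℕ), e ≤ 1 →
        ((Finset.range e).image (fun _ => a)).card = e := by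
      intro e a he
      interval_cases e <;> simp
    rw [hset, Set.ncard_coe_finset, Finset.card_union_of_disjoint,
      Finset.card_union_of_disjoint, hcard _ _ he₀, hcard _ _ he₁,
      Finset.card_image_of_injective _ (Prod.mk_right_injective 0), Nat.card_Ico] at hcount
    · omega
    · simp only [Finset.disjoint_left, Finset.mem_image]
      rintro _ ⟨x, hx, rfl⟩ ⟨y, hy, hxy⟩
      simp at hxy
    · simp only [Finset.disjoint_left, Finset.mem_image, Finset.mem_union]
      rintro _ ⟨x, hx, rfl⟩ (⟨y, hy, hxy⟩ | ⟨y, hy, hxy⟩) <;> simp at hxy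
  · have hdom : l + m < i → i - (l + m) + e₁ ≤ i - l + e₀ := by
      intro hlt
      have hm : mu i ≤ 0 := ((mem_skewCells_fatHook (N := N) (i := i) (r := i) (c := 0) h).2
        (by omega)).1
      have hrow := hT.2.2.1 i 0 1 (by omega) hm (by simp only [fatHook]; split_ifs <;> omega)
      have := hc₀ i hlt le_rfl
      have := hc₁ i (by omega) le_rfl
      omega
    have hnu : ∀ k, 1 ≤ k → (nu k = 2 ↔ k ≤ i - (l + m) - e₀) := by
      intro k hk
      have hcount : {q ∈ skewCells (fatHook N i) mu | T q = k + 1}.ncard = nu k :=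
        hT.2.2.2.2.1 (k + 1) (by omega)
      rw [← hcount]
      constructor
      · intro htwo
        by_contra hgt
        have hsub : {q ∈ skewCells (fatHook N i) mu | T q = k + 1} ⊆ {(l + k + e₁, 1)} := by
          rintro ⟨r, c⟩ ⟨hm, hv⟩
          rw [Set.mem_singleton_iff, Prod.mk.injEq]
          rcases (mem_skewCells_fatHook h).1 hm with
            ⟨rfl, hc⟩ | ⟨h1, hi', ⟨rfl, hc⟩ | ⟨rfl, hc⟩⟩
          · have := hT.fatHook_row_zero hc.1 hc.2
            omega
          · have := hc₀ r hc hi'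
            omega
          · have := hc₁ r hc hi'
            omega
        have := Set.ncard_le_ncard hsub
        rw [Set.ncard_singleton] at this
        omega
      · intro hle
        have hset : {q ∈ skewCells (fatHook N i) mu | T q = k + 1} =
            {(l + m + k + e₀, 0), (l + k + e₁, 1)} := by
          ext ⟨r, c⟩
          simp only [Set.mem_ofPred_eq, Set.mem_insert_iff, Set.mem_singleton_iff, Prod.mk.injEq]
          rw [mem_skewCells_fatHook h]
          constructor
          · rintro ⟨⟨rfl, hc⟩ | ⟨h1, hi', ⟨rfl, hc⟩ | ⟨rfl, hc⟩⟩, hv⟩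
            · have := hT.fatHook_row_zero hc.1 hc.2
              omega
            · have := hc₀ r hc hi'
              omega
            · have := hc₁ r hc hi'
              omega
          · rintro (⟨rfl, rfl⟩ | ⟨rfl, rfl⟩)
            · have := hc₀ (l + m + k + e₀) (by omega) (by omega)
              omega
            · have := hc₁ (l + k + e₁) (by omega) (by omega)
              omega
        rw [hset, Set.ncard_pair (by simp)]
    have hset : {r : ℕ | 1 ≤ r ∧ nu r = 2} =
        (Finset.Icc 1 (i - (l + m) - e₀) : Finset ℕ) := by
      ext r
      simp only [Set.mem_ofPred_eq, Finset.coe_Icc, Set.mem_Icc]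
      exact and_congr_right fun hr => hnu r hr
    rw [hset, Set.ncard_coe_finset, Nat.card_Icc]
    omega

theorem IsLRTableau.fatHook_unique {T' : ℕ × ℕ → ℕ} (hT : IsLRTableau (fatHook N i) mu nu T)
    (hT' : IsLRTableau (fatHook N i) mu nu T')
    (hmu0 : mu 0 ≤ N - 2 * i) (hlm : l + m ≤ i)
    (h : ∀ r, 1 ≤ r → mu r = if r ≤ l then 2 else if r ≤ l + m then 1 else 0) : T = T' := by
  obtain ⟨e₀, -, e₁, -, hc₀, hc₁, hq, hs⟩ := hT.exists_fatHook_params hmu0 hlm h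
  obtain ⟨f₀, -, f₁, -, hd₀, hd₁, hq', hs'⟩ := hT'.exists_fatHook_params hmu0 hlm h
  funext ⟨r, c⟩
  by_cases hm : (r, c) ∈ skewCells (fatHook N i) mu
  · rcases (mem_skewCells_fatHook h).1 hm with ⟨rfl, hc⟩ | ⟨h1, hi', ⟨rfl, hc⟩ | ⟨rfl, hc⟩⟩
    · rw [hT.fatHook_row_zero hc.1 hc.2, hT'.fatHook_row_zero hc.1 hc.2]
    · have := hc₀ r hc hi'
      have := hd₀ r hc hi'
      omega
    · have := hc₁ r hc hi'
      have := hd₁ r hc hi'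
      omega
  · rw [hT.1 _ hm, hT'.1 _ hm]

end FatHook

/-- Fix `i ≥ 1`, `N ≥ 2i + 2` and `λ = (N-2i, 2^i)`. Let `μ, ν ⊆ λ` be partitions with
`|μ| + |ν| = N`; set `p = μ₁`, `d = |μ|`, `ℓ = #{j ≥ 2 : μ_j = 2}`, `q = ν₁`,
`s = #{j ≥ 2 : ν_j = 2}`. Then `c(λ; μ, ν) ≤ 1`, and if `c(λ; μ, ν) ≠ 0` then `(q, s)`
is one of the four pairs `(N-2i-p, p+i-d+ℓ)`, `(N-2i-p+1, p+i-d+ℓ)`,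
`(N-2i-p+1, p+i-d+ℓ-1)`, `(N-2i-p+2, p+i-d+ℓ-1)`. -/
theorem lrCoeff_fatHook_le_one (N i : ℕ) (hi : 1 ≤ i) (hN : 2 * i + 2 ≤ N)
    (mu nu : ℕ → ℕ) (hmu : Antitone mu) (hnu : Antitone nu)
    (hmusub : ∀ r, mu r ≤ fatHook N i r) (hnusub : ∀ r, nu r ≤ fatHook N i r)
    (hsum : (∑ᶠ r, mu r) + (∑ᶠ r, nu r) = N)
    (p d l q s : ℕ)
    (hp : p = mu 0) (hd : d = ∑ᶠ r, mu r) (hl : l = {r : ℕ | 1 ≤ r ∧ mu r = 2}.ncard)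
    (hq : q = nu 0) (hs : s = {r : ℕ | 1 ≤ r ∧ nu r = 2}.ncard) :
    lrCoeff (fatHook N i) mu nu ≤ 1 ∧
    (lrCoeff (fatHook N i) mu nu ≠ 0 →
      ((q : ℤ) = N - 2 * i - p ∧ (s : ℤ) = p + i - d + l) ∨
      ((q : ℤ) = N - 2 * i - p + 1 ∧ (s : ℤ) = p + i - d + l) ∨
      ((q : ℤ) = N - 2 * i - p + 1 ∧ (s : ℤ) = p + i - d + l - 1) ∨
      ((q : ℤ) = N - 2 * i - p + 2 ∧ (s : ℤ) = p + i - d + l - 1)) := by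
  obtain ⟨l', m, hlm, h⟩ := exists_fatHook_subpartition hmu hmusub
  have hmu0 : mu 0 ≤ N - 2 * i := by simpa [fatHook] using hmusub 0
  rw [finsum_eq_of_two_one_tail h] at hd
  rw [ncard_eq_two_of_two_one_tail h] at hl
  refine ⟨?_, fun hne => ?_⟩
  · have hsub : {T | IsLRTableau (fatHook N i) mu nu T}.Subsingleton :=
      fun T hT T' hT' => IsLRTableau.fatHook_unique hT hT' hmu0 hlm h
    have := hsub.finite.to_subtype
    exact Set.ncard_le_one_iff_subsingleton.2 hsub
  obtain ⟨T, hT⟩ := Set.nonempty_of_ncard_ne_zero hne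
  obtain ⟨e₀, he₀, e₁, he₁, -, -, hq', hs'⟩ :=
    IsLRTableau.exists_fatHook_params hT hmu0 hlm h
  omega

end LRPaper
end

section
/- Let M be a connected matroid with finite ground set E such that |E| = rk(M) + 2 (i.e., M has corank 2). Then M is elementary split: M has no minor isomorphic to U_{0,1} ⊕ U_{1,2} ⊕ U_{1,1}, the matroid on a four-element set {a, b, c, d} of rank 2 in which a is a loop, {b, c} is a circuit of size 2, and d is a coloop (equivalently, whose independent sets are exactly the subsets of {b, c, d} containing at most one of b and c). -/
open Polynomial

namespace KLPaper

variable {α : Type*}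

/-- The rank of a set `X` in a matroid `M`: the largest cardinality of an independent
subset of `X` (sensible for matroids with finite ground set). -/
noncomputable def mrk (M : Matroid α) (X : Set α) : ℕ :=
  sSup {n : ℕ | ∃ I, M.Indep I ∧ I ⊆ X ∧ I.ncard = n}

/-- The rank of a matroid. -/
noncomputable def mrank (M : Matroid α) : ℕ := mrk M M.E

/-- Deletion of a set `D` from a matroid `M`. -/
def mdelete (M : Matroid α) (D : Set α) : Matroid α := M.restrict (M.E \ D)

/-- Contraction of a set `C` in a matroid `M`. -/
def mcontract (M : Matroid α) (C : Set α) : Matroid α := (mdelete M✶ C)✶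

/-- A matroid is loopless if every singleton of the ground set is independent. -/
def mloopless (M : Matroid α) : Prop := ∀ e ∈ M.E, M.Indep {e}


/-- A circuit is a minimal dependent subset of the ground set. -/
def mcircuit (M : Matroid α) (C : Set α) : Prop :=
  C ⊆ M.E ∧ ¬ M.Indep C ∧ ∀ D ⊂ C, M.Indep D

/-- A matroid is connected if every two distinct elements of the ground set lie on a
common circuit. -/
def mconnected (M : Matroid α) : Prop :=
  ∀ x ∈ M.E, ∀ y ∈ M.E, x ≠ y → ∃ C, mcircuit M C ∧ x ∈ C ∧ y ∈ C

theorem mrank_eq_ncard {M : Matroid α} (hfin : M.E.Finite) {B : Set α} (hB : M.IsBase B) :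
    mrank M = B.ncard := by
  refine IsGreatest.csSup_eq ⟨⟨B, hB.indep, hB.subset_ground, rfl⟩, ?_⟩
  rintro n ⟨I, hI, -, rfl⟩
  obtain ⟨B', hB', hIB'⟩ := hI.exists_isBase_superset
  rw [← hB'.ncard_eq_ncard_of_isBase hB]
  exact Set.ncard_le_ncard hIB' (hfin.subset hB'.subset_ground)

theorem mrank_add_ncard_le_of_coindep {M : Matroid α} (hfin : M.E.Finite) {I : Set α}
    (hI : M✶.Indep I) : mrank M + I.ncard ≤ M.E.ncard := by
  obtain ⟨hIE, B, hB, hdj⟩ := Matroid.dual_indep_iff_exists'.1 hI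
  have hBE := hB.subset_ground
  rw [mrank_eq_ncard hfin hB,
    ← Set.ncard_union_eq hdj.symm (hfin.subset hBE) (hfin.subset hIE)]
  exact Set.ncard_le_ncard (Set.union_subset hBE hIE) hfin

theorem mcircuit.isCircuit {M : Matroid α} {C : Set α} (hC : mcircuit M C) : M.IsCircuit C :=
  Matroid.isCircuit_iff_forall_ssubset.2 ⟨⟨hC.2.1, hC.1⟩, fun _ hI ↦ hC.2.2 _ hI⟩

theorem mconnected.not_isColoop {M : Matroid α} (hM : mconnected M) (hE : M.E.Nontrivial)
    (e : α) : ¬ M.IsColoop e := by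
  intro he
  obtain ⟨f, hf, hfe⟩ := hE.exists_ne e
  obtain ⟨C, hC, heC, -⟩ := hM e he.mem_ground f hf hfe.symm
  exact hC.isCircuit.not_isColoop_of_mem heC he

/-- The independent sets of `U_{0,1} ⊕ U_{1,2} ⊕ U_{1,1}` force `d` to be a coloop. -/
theorem isColoop_of_indep_iff {N : Matroid α} {b c d : α} (hbd : b ≠ d) (hcd : c ≠ d)
    (hN : ∀ I, N.Indep I ↔ I ⊆ ({b, c, d} : Set α) ∧ ¬ ({b, c} : Set α) ⊆ I) :
    N.IsColoop d := by
  rw [Matroid.isColoop_iff_forall_mem_isBase]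
  intro B hB
  refine hB.mem_of_insert_indep ((hN _).2 ?_)
  obtain ⟨hsub, hbc⟩ := (hN B).1 hB.indep
  refine ⟨Set.insert_subset (by simp) hsub, fun h ↦ hbc ?_⟩
  rw [Set.pair_subset_iff] at h ⊢
  exact ⟨h.1.resolve_left hbd, h.2.resolve_left hcd⟩

/-- The independent sets of `U_{0,1} ⊕ U_{1,2} ⊕ U_{1,1}` force `{a, c}` to be coindependent. -/
theorem dual_indep_pair_of_indep_iff {N : Matroid α} {a b c d : α} (hab : a ≠ b) (hac : a ≠ c)
    (had : a ≠ d) (hbc : b ≠ c) (hcd : c ≠ d) (hE : N.E = {a, b, c, d})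
    (hN : ∀ I, N.Indep I ↔ I ⊆ ({b, c, d} : Set α) ∧ ¬ ({b, c} : Set α) ⊆ I) :
    N✶.Indep {a, c} := by
  have hbd : N.Indep {b, d} := by
    rw [hN, Set.pair_subset_iff, Set.pair_subset_iff]
    simp [hbc.symm, hcd]
  obtain ⟨B, hB, hsub⟩ := hbd.exists_isBase_superset
  rw [Set.pair_subset_iff] at hsub
  obtain ⟨hB₁, hB₂⟩ := (hN B).1 hB.indep
  refine Matroid.dual_indep_iff_exists'.2 ⟨?_, B, hB, ?_⟩
  · rw [hE, Set.pair_subset_iff]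
    simp
  · rw [Set.disjoint_left]
    rintro x (rfl | rfl) hx
    · simpa [hab, hac, had] using hB₁ hx
    · exact hB₂ (Set.pair_subset hsub.1 hx)

/-- Every connected matroid of corank `2` (finite ground set with `|E| = rk(M) + 2`) is
elementary split: it has no minor isomorphic to `U_{0,1} ⊕ U_{1,2} ⊕ U_{1,1}`, the
rank-`2` matroid on four elements `{a, b, c, d}` in which `a` is a loop, `{b, c}` is a
circuit of size two and `d` is a coloop — equivalently, whose independent sets are
exactly the subsets of `{b, c, d}` containing at most one of `b` and `c`. -/
theorem corank_two_connected_elementary_split (α : Type*) (M : Matroid α)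
    (hfin : M.E.Finite) (hconn : mconnected M)
    (hcorank : M.E.ncard = mrank M + 2) :
    ¬ ∃ (C D : Set α) (a b c d : α),
        C ⊆ M.E ∧ D ⊆ M.E ∧ Disjoint C D ∧
        a ≠ b ∧ a ≠ c ∧ a ≠ d ∧ b ≠ c ∧ b ≠ d ∧ c ≠ d ∧
        (mdelete (mcontract M C) D).E = {a, b, c, d} ∧
        (∀ I, (mdelete (mcontract M C) D).Indep I ↔
          I ⊆ ({b, c, d} : Set α) ∧ ¬ ({b, c} : Set α) ⊆ I) := by
  rintro ⟨C, D, a, b, c, d, -, hDE, hCD, hab, hac, had, hbc, hbd, hcd, hE, hN⟩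
  change ((M.contract C).delete D).E = _ at hE
  change ∀ I, ((M.contract C).delete D).Indep I ↔ _ at hN
  have hsub : ({a, b, c, d} : Set α) ⊆ M.E := by
    rw [← hE]
    exact Set.sdiff_subset.trans Set.sdiff_subset
  have hcol : ∀ e, ¬ M.IsColoop e :=
    hconn.not_isColoop ⟨a, hsub (by simp), b, hsub (by simp), hab⟩
  have hpair := dual_indep_pair_of_indep_iff hab hac had hbc hcd hE hN
  have hd := isColoop_of_indep_iff hbd hcd hN
  have hD : D = ∅ := by
    by_contra! hne
    obtain ⟨e, he⟩ := hne
    have heI : (M✶.delete C).Indep {e} := by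
      rw [Matroid.indep_singleton, Matroid.delete_isNonloop_iff]
      refine ⟨?_, hCD.notMem_of_mem_right he⟩
      rw [← Matroid.not_isLoop_iff (M := M✶) (hDE he), Matroid.dual_isLoop_iff_isColoop]
      exact hcol e
    obtain ⟨I, hI, heI⟩ := heI.subset_isBasis'_of_subset (Set.singleton_subset_iff.2 he)
    rw [Matroid.dual_contract_delete, hI.contract_indep_iff] at hpair
    obtain ⟨hind, hdj⟩ := hpair
    have hea : e ≠ a := fun h ↦ Set.disjoint_left.1 hdj he (by simp [h])
    have hec : e ≠ c := fun h ↦ Set.disjoint_left.1 hdj he (by simp [h])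
    have hthree : M✶.Indep {e, a, c} := hind.of_delete.subset <|
      Set.insert_subset (Or.inr (heI rfl)) Set.subset_union_left
    have hle := mrank_add_ncard_le_of_coindep hfin hthree
    rw [Set.ncard_eq_three.2 ⟨e, a, c, hea, hec, hac, rfl⟩] at hle
    omega
  rw [hD, Matroid.delete_empty, Matroid.contract_isColoop_iff] at hd
  exact hcol d hd.1

end KLPaper
end
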